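/- arXiv:1811.05336 — 4 statements merged into one kernel-verified Lean document; each statement's English description precedes it below -/
import Mathlib

section
/- Let p, k be positive integers and let S : ℝ → Matrix (Fin p) (Fin p) ℝ and L : ℝ → Matrix (Fin p) (Fin k) ℝ be functions differentiable at t₀ ∈ ℝ such that for all t ∈ ℝ, all i ∈ Fin p and r ∈ Fin k: ∑_{z ≠ i} L(t) z r · S(t) i z = ∑_{z ≠ i} L(t) z r · ∑_{t'} L(t) i t' · L(t) z t'. Write λ_{jt} = L(t₀) j t, σ_{xy} = S(t₀) x y, and let λ'_{jt}, σ'_{xy} denote the corresponding entries of the derivatives of L and S at t₀. Then for all i, r: ∑_{z ≠ i} λ_{zr} σ'_{iz} = ∑_{z ≠ i} (∑_{t} λ_{it} λ_{zt} − σ_{iz} + λ_{zr} λ_{ir}) λ'_{zr} + ∑_{t} (∑_{z ≠ i} λ_{zr} λ_{zt}) λ'_{it} + ∑_{z ≠ i} ∑_{t ≠ r} λ_{zr} λ_{it} λ'_{zt}. -/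
open Finset

/-- Differential form of the first-order condition of least-square factor analysis along
differentiable paths `t ↦ S t` and `t ↦ L t`. -/
theorem stmt2 (p k : ℕ) (hp : 0 < p) (hk : 0 < k)
    (S : ℝ → Matrix (Fin p) (Fin p) ℝ) (L : ℝ → Matrix (Fin p) (Fin k) ℝ)
    (t₀ : ℝ)
    (S' : Matrix (Fin p) (Fin p) ℝ) (L' : Matrix (Fin p) (Fin k) ℝ)
    (hS : ∀ x y, HasDerivAt (fun t => S t x y) (S' x y) t₀)
    (hL : ∀ j u, HasDerivAt (fun t => L t j u) (L' j u) t₀)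
    (heq : ∀ (t : ℝ) (i : Fin p) (r : Fin k),
      ∑ z ∈ Finset.univ.filter (fun z => z ≠ i), L t z r * S t i z =
        ∑ z ∈ Finset.univ.filter (fun z => z ≠ i), L t z r * ∑ u, L t i u * L t z u)
    (i : Fin p) (r : Fin k) :
    ∑ z ∈ Finset.univ.filter (fun z => z ≠ i), L t₀ z r * S' i z =
      (∑ z ∈ Finset.univ.filter (fun z => z ≠ i),
          (∑ u, L t₀ i u * L t₀ z u - S t₀ i z + L t₀ z r * L t₀ i r) * L' z r)
        + (∑ u, (∑ z ∈ Finset.univ.filter (fun z => z ≠ i), L t₀ z r * L t₀ z u) * L' i u)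
        + ∑ z ∈ Finset.univ.filter (fun z => z ≠ i),
            ∑ u ∈ Finset.univ.filter (fun u => u ≠ r), L t₀ z r * L t₀ i u * L' z u := by
  have hl := HasDerivAt.fun_sum (u := Finset.univ.filter (fun z => z ≠ i))
    fun z _ => (hL z r).fun_mul (hS i z)
  have hr := HasDerivAt.fun_sum (u := Finset.univ.filter (fun z => z ≠ i))
    fun z _ => (hL z r).fun_mul
      (HasDerivAt.fun_sum (u := Finset.univ) fun u _ => (hL i u).fun_mul (hL z u))
  have key := hl.unique (by simpa only [heq] using hr)
  have split_r : ∀ z, ∑ u, L t₀ z r * L t₀ i u * L' z u =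
      L t₀ z r * L t₀ i r * L' z r +
        ∑ u ∈ Finset.univ.filter (fun u => u ≠ r), L t₀ z r * L t₀ i u * L' z u := by
    intro z
    rw [Finset.filter_ne']
    exact (Finset.add_sum_erase _ (fun u => L t₀ z r * L t₀ i u * L' z u) (Finset.mem_univ r)).symm
  have swap : ∑ u, (∑ z ∈ Finset.univ.filter (fun z => z ≠ i), L t₀ z r * L t₀ z u) * L' i u =
      ∑ z ∈ Finset.univ.filter (fun z => z ≠ i), ∑ u, L t₀ z r * L t₀ z u * L' i u := by
    simp only [Finset.sum_mul]
    exact Finset.sum_comm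
  rw [swap, ← Finset.sum_add_distrib, ← Finset.sum_add_distrib]
  rw [Finset.sum_add_distrib, ← eq_sub_iff_add_eq', ← Finset.sum_sub_distrib] at key
  rw [key]
  refine Finset.sum_congr rfl fun z _ => ?_
  have expand : L t₀ z r * ∑ u, (L' i u * L t₀ z u + L t₀ i u * L' z u) =
      ∑ u, L t₀ z r * L t₀ z u * L' i u + ∑ u, L t₀ z r * L t₀ i u * L' z u := by
    rw [Finset.mul_sum, ← Finset.sum_add_distrib]
    exact Finset.sum_congr rfl fun u _ => by ring
  linear_combination expand + split_r z
end

section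
/- Let p, k be positive integers and let S : ℝ → Matrix (Fin p) (Fin p) ℝ, L : ℝ → Matrix (Fin p) (Fin k) ℝ, and G : ℝ → Matrix (Fin p) (Fin k) ℝ be differentiable at t₀ ∈ ℝ such that for all t ∈ ℝ, all i ∈ Fin p and r ∈ Fin k: ∑_{s ≠ i} S(t) i s · G(t) s r + (∑_{t'} (L(t) i t')²) · G(t) i r = L(t) i r · ∑_{s} L(t) s r · G(t) s r. Write λ_{jt} = L(t₀) j t, γ_{jt} = G(t₀) j t, σ_{xy} = S(t₀) x y, h_i = ∑_{t} λ_{it}², and let λ', γ', σ' denote entries of the derivatives at t₀. Then for all i, r: ∑_{s ≠ i} γ_{sr} σ'_{is} = ∑_{s ≠ i} (λ_{ir} λ_{sr} − σ_{is}) γ'_{sr} + (λ_{ir}² − h_i) γ'_{ir} + (∑_{s ≠ i} λ_{sr} γ_{sr}) λ'_{ir} − 2 γ_{ir} ∑_{t ≠ r} λ_{it} λ'_{it} + λ_{ir} ∑_{s ≠ i} γ_{sr} λ'_{sr}. -/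
open Finset

/-- Differential form of the componentwise alpha factor analysis relation
`∑_{s≠i} σ_{is}γ_{sr} + h_iγ_{ir} = λ_{ir}∑_s λ_{sr}γ_{sr}` along differentiable paths
of `S`, `L`, `G`. -/
theorem stmt8 (p k : ℕ) (hp : 0 < p) (hk : 0 < k)
    (S : ℝ → Matrix (Fin p) (Fin p) ℝ)
    (L G : ℝ → Matrix (Fin p) (Fin k) ℝ)
    (t₀ : ℝ)
    (S' : Matrix (Fin p) (Fin p) ℝ) (L' G' : Matrix (Fin p) (Fin k) ℝ)
    (hS : ∀ x y, HasDerivAt (fun t => S t x y) (S' x y) t₀)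
    (hL : ∀ j u, HasDerivAt (fun t => L t j u) (L' j u) t₀)
    (hG : ∀ j u, HasDerivAt (fun t => G t j u) (G' j u) t₀)
    (heq : ∀ (t : ℝ) (i : Fin p) (r : Fin k),
      ∑ s ∈ Finset.univ.filter (fun s => s ≠ i), S t i s * G t s r
          + (∑ u, (L t i u) ^ 2) * G t i r =
        L t i r * ∑ s, L t s r * G t s r)
    (i : Fin p) (r : Fin k) :
    ∑ s ∈ Finset.univ.filter (fun s => s ≠ i), G t₀ s r * S' i s =
      (∑ s ∈ Finset.univ.filter (fun s => s ≠ i),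
          (L t₀ i r * L t₀ s r - S t₀ i s) * G' s r)
        + (L t₀ i r ^ 2 - ∑ u, (L t₀ i u) ^ 2) * G' i r
        + (∑ s ∈ Finset.univ.filter (fun s => s ≠ i), L t₀ s r * G t₀ s r) * L' i r
        - 2 * G t₀ i r * ∑ u ∈ Finset.univ.filter (fun u => u ≠ r), L t₀ i u * L' i u
        + L t₀ i r * ∑ s ∈ Finset.univ.filter (fun s => s ≠ i), G t₀ s r * L' s r := by
  have split {n : ℕ} (f : Fin n → ℝ) (a : Fin n) :
      ∑ s, f s = f a + ∑ s ∈ Finset.univ.filter (fun s => s ≠ a), f s := by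
    rw [Finset.filter_ne', Finset.add_sum_erase _ _ (Finset.mem_univ a)]
  have hlhs := (HasDerivAt.fun_sum (u := Finset.univ.filter (fun s => s ≠ i))
      fun s _ => (hS i s).fun_mul (hG s r)).fun_add
    ((HasDerivAt.fun_sum (u := Finset.univ) fun u _ => (hL i u).fun_pow 2).fun_mul (hG i r))
  have hrhs := (hL i r).fun_mul
    (HasDerivAt.fun_sum (u := Finset.univ) fun s _ => (hL s r).fun_mul (hG s r))
  simp only [heq _ i r] at hlhs
  have key := hlhs.unique hrhs
  rw [split (fun s => L t₀ s r * G t₀ s r) i,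
    split (fun s => L' s r * G t₀ s r + L t₀ s r * G' s r) i,
    split (fun u => _ * L t₀ i u ^ (2 - 1) * L' i u) r] at key
  simp only [Nat.cast_ofNat, Nat.add_one_sub_one, pow_one, mul_assoc, ← Finset.mul_sum,
    Finset.sum_add_distrib] at key
  simp only [sub_mul, mul_assoc, Finset.sum_sub_distrib, ← Finset.mul_sum,
    mul_comm (G t₀ _ r)]
  linear_combination key
end

section
/- Let p be a positive integer, let S be an invertible symmetric p×p real matrix, fix i ∈ Fin p, and assume (S⁻¹) i i ≠ 0. Then the map f : Matrix (Fin p) (Fin p) ℝ → ℝ defined by f(A) = 1 / ((A⁻¹) i i) has a Fréchet derivative at S given by the linear map H ↦ ∑_{s,t} ((S⁻¹) i s · (S⁻¹) i t / ((S⁻¹) i i)²) · H s t. -/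
section LinftyOp

attribute [local instance] Matrix.linftyOpNormedRing Matrix.linftyOpNormedAlgebra

/-- The Fréchet derivative at `S` of an entry of the inverse matrix is
`H ↦ -(S⁻¹ * H * S⁻¹) i j`. -/
theorem Matrix.exists_hasFDerivAt_inv_apply {n : Type*} [Fintype n] [DecidableEq n]
    (S : Matrix n n ℝ) (hS : IsUnit S.det) (i j : n) :
    ∃ f : Matrix n n ℝ →L[ℝ] ℝ,
      HasFDerivAt (fun A : Matrix n n ℝ => A⁻¹ i j) f S ∧
        ∀ H, f H = -(S⁻¹ * H * S⁻¹) i j := by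
  obtain ⟨u, rfl⟩ := (Matrix.isUnit_iff_isUnit_det S).mpr hS
  let e : Matrix n n ℝ →L[ℝ] ℝ :=
    LinearMap.toContinuousLinearMap (Matrix.entryLinearMap ℝ ℝ i j)
  refine ⟨_, (e.hasFDerivAt.comp _ (hasFDerivAt_ringInverse (𝕜 := ℝ) u)).congr_of_eventuallyEq
    (.of_forall fun A => congrArg e (Matrix.nonsing_inv_eq_ringInverse A)), fun H => ?_⟩
  rw [← Matrix.coe_units_inv]
  rfl

/-- The Fréchet derivative at `S` of the reciprocal of an entry of the inverse matrix is
`H ↦ (S⁻¹ * H * S⁻¹) i j / (S⁻¹ i j) ^ 2`. -/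
theorem Matrix.exists_hasFDerivAt_one_div_inv_apply {n : Type*} [Fintype n] [DecidableEq n]
    (S : Matrix n n ℝ) (hS : IsUnit S.det) (i j : n) (hne : S⁻¹ i j ≠ 0) :
    ∃ f : Matrix n n ℝ →L[ℝ] ℝ,
      HasFDerivAt (fun A : Matrix n n ℝ => 1 / A⁻¹ i j) f S ∧
        ∀ H, f H = (S⁻¹ * H * S⁻¹) i j / (S⁻¹ i j) ^ 2 := by
  obtain ⟨f, hf, hfH⟩ := Matrix.exists_hasFDerivAt_inv_apply S hS i j
  refine ⟨-((S⁻¹ i j) ^ 2)⁻¹ • f, ?_, fun H => ?_⟩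
  · simp only [one_div]
    exact (hasDerivAt_inv hne).comp_hasFDerivAt S hf
  · change -((S⁻¹ i j) ^ 2)⁻¹ * f H = _
    rw [hfH]
    ring

end LinftyOp

/-- For an invertible symmetric matrix `S` with `(S⁻¹) i i ≠ 0`, the map
`A ↦ 1 / (A⁻¹) i i` has Fréchet derivative at `S` given by
`H ↦ ∑ s t, ((S⁻¹) i s * (S⁻¹) i t / ((S⁻¹) i i)²) * H s t`. -/
theorem stmt10 (p : ℕ) (hp : 0 < p)
    (S : Matrix (Fin p) (Fin p) ℝ) (hinv : IsUnit S.det) (hsymm : S.IsSymm)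
    (i : Fin p) (hne : S⁻¹ i i ≠ 0) :
    ∃ f : Matrix (Fin p) (Fin p) ℝ →L[ℝ] ℝ,
      HasFDerivAt (fun A : Matrix (Fin p) (Fin p) ℝ => 1 / A⁻¹ i i) f S ∧
        ∀ H : Matrix (Fin p) (Fin p) ℝ,
          f H = ∑ s, ∑ t, (S⁻¹ i s * S⁻¹ i t / (S⁻¹ i i) ^ 2) * H s t := by
  obtain ⟨f, hf, hfH⟩ := Matrix.exists_hasFDerivAt_one_div_inv_apply S hinv i i hne
  have hs : ∀ t, S⁻¹ t i = S⁻¹ i t := fun t => by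
    rw [← Matrix.transpose_apply S⁻¹, Matrix.transpose_nonsing_inv, hsymm.eq]
  refine ⟨f, hf, fun H => ?_⟩
  simp only [hfH, Matrix.mul_apply, Finset.sum_mul, Finset.sum_div, hs]
  rw [Finset.sum_comm]
  refine Finset.sum_congr rfl fun s _ => Finset.sum_congr rfl fun t _ => ?_
  ring
end

section
/- Let p, k be positive integers and let S : ℝ → Matrix (Fin p) (Fin p) ℝ, L : ℝ → Matrix (Fin p) (Fin k) ℝ, and τ : ℝ → ℝ be differentiable at t₀ ∈ ℝ, with S(t) invertible and symmetric and (S(t)⁻¹) i i ≠ 0 for all i and all t, and suppose that for all t ∈ ℝ: τ(t) · ∑_{i} (1/((S(t)⁻¹) i i))² = ∑_{i} (1/((S(t)⁻¹) i i)) · (S(t) i i − ∑_{t'} (L(t) i t')²). Write σ_{xy} = S(t₀) x y, σ^{xy} = (S(t₀)⁻¹) x y, λ_{it} = L(t₀) i t, h_i = ∑_{t} λ_{it}², τ₀ = τ(t₀), and let σ', λ', τ' denote the derivatives at t₀. Then: (∑_{i} (1/σ^{ii})²) · τ' = ∑_{s,t} (∑_{i} (σ_{ii} − h_i − 2τ₀/σ^{ii})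 · σ^{is} σ^{it} / (σ^{ii})²) · σ'_{st} + ∑_{i} (1/σ^{ii}) · (σ'_{ii} − 2 ∑_{s} λ_{is} λ'_{is}). -/
open Finset

open scoped Topology in
/-- The entrywise derivative of the inverse of a differentiable path of matrices,
`d(A⁻¹) = -A⁻¹ (dA) A⁻¹`. -/
theorem hasDerivAt_matrix_inv_apply {n : Type*} [Fintype n] [DecidableEq n]
    {S : ℝ → Matrix n n ℝ} {S' : Matrix n n ℝ} {t₀ : ℝ} (hSinv : ∀ t, IsUnit (S t).det)
    (hS : ∀ x y, HasDerivAt (fun t => S t x y) (S' x y) t₀) (i j : n) :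
    HasDerivAt (fun t => (S t)⁻¹ i j) (-((S t₀)⁻¹ * S' * (S t₀)⁻¹) i j) t₀ := by
  have hcont : ContinuousAt S t₀ :=
    continuousAt_pi.2 fun x => continuousAt_pi.2 fun y => (hS x y).continuousAt
  have hdet : ContinuousAt (fun t => (S t).det) t₀ :=
    (Continuous.matrix_det continuous_id).continuousAt.comp hcont
  have hadj : ContinuousAt (fun t => (S t).adjugate) t₀ :=
    (Continuous.matrix_adjugate continuous_id).continuousAt.comp hcont
  have hinv : ContinuousAt (fun t => (S t)⁻¹) t₀ := by
    simp only [Matrix.inv_def, Ring.inverse_eq_inv']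
    exact (hdet.inv₀ (hSinv t₀).ne_zero).smul hadj
  have hslope : Filter.Tendsto (fun t => (t - t₀)⁻¹ • (S t - S t₀)) (𝓝[≠] t₀) (𝓝 S') :=
    tendsto_pi_nhds.2 fun x => tendsto_pi_nhds.2 fun y => (hS x y).tendsto_slope
  have hprod := (((hinv.tendsto.mono_left nhdsWithin_le_nhds).mul hslope).mul
    (tendsto_const_nhds (x := (S t₀)⁻¹))).neg
  rw [hasDerivAt_iff_tendsto_slope]
  refine (tendsto_pi_nhds.1 (tendsto_pi_nhds.1 hprod i) j).congr fun t => ?_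
  have hdiff : (S t)⁻¹ * (S t - S t₀) * (S t₀)⁻¹ = (S t₀)⁻¹ - (S t)⁻¹ := by
    rw [mul_sub, sub_mul, Matrix.nonsing_inv_mul _ (hSinv t), one_mul, mul_assoc,
      Matrix.mul_nonsing_inv _ (hSinv t₀), mul_one]
  rw [Matrix.mul_smul, Matrix.smul_mul, hdiff]
  simp only [Matrix.neg_apply, Matrix.smul_apply, Matrix.sub_apply, slope, vsub_eq_sub,
    smul_eq_mul]
  ring

/-- Differential form of the regression identity for `τ` in image factor analysis,
`τ·dot(diag Δ, diag Δ) = dot(diag Δ, diag(Σ − ΛΛ'))` with `Δ = (Diag Σ⁻¹)⁻¹`, along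
differentiable paths `t ↦ S t`, `t ↦ L t`, `t ↦ τ t`. -/
theorem stmt13 (p k : ℕ) (hp : 0 < p) (hk : 0 < k)
    (S : ℝ → Matrix (Fin p) (Fin p) ℝ) (L : ℝ → Matrix (Fin p) (Fin k) ℝ) (τ : ℝ → ℝ)
    (t₀ : ℝ)
    (hSinv : ∀ t, IsUnit (S t).det) (hSsymm : ∀ t, (S t).IsSymm)
    (hSne : ∀ t i, (S t)⁻¹ i i ≠ 0)
    (S' : Matrix (Fin p) (Fin p) ℝ) (L' : Matrix (Fin p) (Fin k) ℝ) (τ' : ℝ)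
    (hS : ∀ x y, HasDerivAt (fun t => S t x y) (S' x y) t₀)
    (hL : ∀ j u, HasDerivAt (fun t => L t j u) (L' j u) t₀)
    (hτ : HasDerivAt τ τ' t₀)
    (heq : ∀ t : ℝ,
      τ t * ∑ i, (1 / (S t)⁻¹ i i) ^ 2 =
        ∑ i, (1 / (S t)⁻¹ i i) * (S t i i - ∑ u, (L t i u) ^ 2)) :
    (∑ i, (1 / (S t₀)⁻¹ i i) ^ 2) * τ' =
      (∑ s, ∑ t,
          (∑ i, (S t₀ i i - (∑ u, (L t₀ i u) ^ 2) - 2 * τ t₀ / (S t₀)⁻¹ i i)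
            * ((S t₀)⁻¹ i s * (S t₀)⁻¹ i t / ((S t₀)⁻¹ i i) ^ 2)) * S' s t)
        + ∑ i, (1 / (S t₀)⁻¹ i i) * (S' i i - 2 * ∑ s, L t₀ i s * L' i s) := by
  have hsum : ∀ i, ((S t₀)⁻¹ * S' * (S t₀)⁻¹) i i
      = ∑ s, ∑ t, (S t₀)⁻¹ i s * (S t₀)⁻¹ i t * S' s t := by
    intro i
    simp only [Matrix.mul_apply, sum_mul]
    rw [sum_comm]
    refine sum_congr rfl fun s _ => sum_congr rfl fun t _ => ?_
    rw [(hSsymm t₀).inv.apply i t]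
    ring
  set D : Fin p → ℝ := fun i => ((S t₀)⁻¹ * S' * (S t₀)⁻¹) i i / ((S t₀)⁻¹ i i) ^ 2 with hD
  have hΔ : ∀ i, HasDerivAt (fun t => 1 / (S t)⁻¹ i i) (D i) t₀ := by
    intro i
    simpa [hD] using (hasDerivAt_matrix_inv_apply hSinv hS i i).fun_inv (hSne t₀ i)
  have hleft := hτ.fun_mul (HasDerivAt.fun_sum fun i (_ : i ∈ univ) => (hΔ i).fun_pow 2)
  have hright := HasDerivAt.fun_sum fun i (_ : i ∈ univ) => (hΔ i).fun_mul
    ((hS i i).fun_sub (HasDerivAt.fun_sum fun u (_ : u ∈ univ) => (hL i u).fun_pow 2))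
  have key := hleft.unique (hright.congr_of_eventuallyEq (Filter.Eventually.of_forall heq))
  have hcoef : ∀ c : Fin p → ℝ,
      ∑ s, ∑ t, (∑ i, c i * ((S t₀)⁻¹ i s * (S t₀)⁻¹ i t / ((S t₀)⁻¹ i i) ^ 2)) * S' s t
        = ∑ i, c i * D i := by
    intro c
    simp only [hD, hsum, sum_mul, mul_sum, sum_div]
    rw [sum_comm_cycle]
    refine sum_congr rfl fun i _ => sum_congr rfl fun s _ => sum_congr rfl fun t _ => ?_
    ring
  rw [hcoef, ← sum_add_distrib, mul_comm, eq_sub_of_add_eq key, mul_sum, ← sum_sub_distrib]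
  refine sum_congr rfl fun i _ => ?_
  simp only [mul_sum]
  push_cast
  ring_nf
end
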